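/- If Y is a non-degenerate binary random variable (𝒴 = {0,1} with 0 < P_Y(1) < 1) that is not independent of X, then g_0(X;Y) = 0: every random variable Z with X–Y–Z a Markov chain and Z independent of X is also independent of Y. -/

import Mathlib

open scoped BigOperators

noncomputable section

namespace RatePrivacy

variable {α β γ : Type*}

/-- `p` is a probability mass function on a finite alphabet. -/
def IsPMF [Fintype α] (p : α → ℝ) : Prop := (∀ a, 0 ≤ p a) ∧ ∑ a, p a = 1

/-- Shannon entropy (in bits) of the distribution `p`. -/
def ent [Fintype α] (p : α → ℝ) : ℝ := ∑ a, -(p a * Real.logb 2 (p a))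

/-- First marginal of a joint distribution. -/
def margA [Fintype α] [Fintype β] (p : α × β → ℝ) : α → ℝ := fun a => ∑ b, p (a, b)

/-- Second marginal of a joint distribution. -/
def margB [Fintype α] [Fintype β] (p : α × β → ℝ) : β → ℝ := fun b => ∑ a, p (a, b)

/-- Mutual information (in bits) of a joint distribution `p`:
`I(A;B) = H(A) + H(B) - H(A,B)`. -/
def mi [Fintype α] [Fintype β] (p : α × β → ℝ) : ℝ :=
  ent (margA p) + ent (margB p) - ent p

/-- `q` is a (row-stochastic) channel. -/
def IsChannel [Fintype γ] (q : β → γ → ℝ) : Prop :=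
  (∀ y z, 0 ≤ q y z) ∧ ∀ y, ∑ z, q y z = 1

/-- Joint distribution of `(X, Z)` when `Z` is obtained from `Y` through the channel `q`
(so that `X — Y — Z` is a Markov chain). -/
def jointXZ [Fintype α] [Fintype β] [Fintype γ] (p : α × β → ℝ) (q : β → γ → ℝ) :
    α × γ → ℝ := fun xz => ∑ y, p (xz.1, y) * q y xz.2

/-- Joint distribution of `(Y, Z)` when `Z` is obtained from `Y` through the channel `q`. -/
def jointYZ [Fintype α] [Fintype β] [Fintype γ] (p : α × β → ℝ) (q : β → γ → ℝ) :
    β × γ → ℝ := fun yz => margB p yz.1 * q yz.1 yz.2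

/-- Achievable rates `I(Y;Z)` over all privacy filters `Z` (on finite alphabets, wlog `Fin n`)
with `X — Y — Z` Markov and `I(X;Z) ≤ ε`. -/
def gSet [Fintype α] [Fintype β] (p : α × β → ℝ) (ε : ℝ) : Set ℝ :=
  { r | ∃ (n : ℕ) (q : β → Fin n → ℝ), IsChannel q ∧
        mi (jointXZ p q) ≤ ε ∧ r = mi (jointYZ p q) }

/-- The rate-privacy function `g_ε(X;Y)` (privacy measured by mutual information). -/
def g [Fintype α] [Fintype β] (p : α × β → ℝ) (ε : ℝ) : ℝ := sSup (gSet p ε)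

/-- Values `E[f(A) g(B)]` over all zero-mean unit-variance `f, g`, used to define
the Hirschfeld–Gebelein–Rényi maximal correlation. -/
def corrSet [Fintype α] [Fintype β] (p : α × β → ℝ) : Set ℝ :=
  { r | ∃ (f : α → ℝ) (g : β → ℝ),
      (∑ a, margA p a * f a = 0) ∧ (∑ b, margB p b * g b = 0) ∧
      (∑ a, margA p a * (f a) ^ 2 = 1) ∧ (∑ b, margB p b * (g b) ^ 2 = 1) ∧
      r = ∑ x : α × β, p x * (f x.1 * g x.2) }

/-- Maximal correlation `ρ_m(A;B)` (equal to `0` when the constraint set is empty,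
since `sSup ∅ = 0` in `ℝ`). -/
def rhoM [Fintype α] [Fintype β] (p : α × β → ℝ) : ℝ := sSup (corrSet p)

/-- Achievable rates with maximal-correlation privacy constraint `ρ_m²(X;Z) ≤ ε`. -/
def ghSet [Fintype α] [Fintype β] (p : α × β → ℝ) (ε : ℝ) : Set ℝ :=
  { r | ∃ (n : ℕ) (q : β → Fin n → ℝ), IsChannel q ∧
        (rhoM (jointXZ p q)) ^ 2 ≤ ε ∧ r = mi (jointYZ p q) }

/-- The rate-privacy function `ĝ_ε(X;Y)` (privacy measured by squared maximal correlation). -/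
def gh [Fintype α] [Fintype β] (p : α × β → ℝ) (ε : ℝ) : ℝ := sSup (ghSet p ε)

/-- The Kullback–Leibler divergence (in bits) `D(P_{X|Y}(·|y) ‖ P_X)`. -/
def Dxy [Fintype α] [Fintype β] (p : α × β → ℝ) (y : β) : ℝ :=
  ∑ x, (p (x, y) / margB p y) * Real.logb 2 ((p (x, y) / margB p y) / margA p x)

theorem margA_nonneg [Fintype α] [Fintype β] {p : α × β → ℝ} (hp : IsPMF p) (a : α) :
    0 ≤ margA p a :=
  Finset.sum_nonneg fun _ _ => hp.1 _

theorem margB_nonneg [Fintype α] [Fintype β] {p : α × β → ℝ} (hp : IsPMF p) (b : β) :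
    0 ≤ margB p b :=
  Finset.sum_nonneg fun _ _ => hp.1 _

theorem sum_margA [Fintype α] [Fintype β] (p : α × β → ℝ) :
    ∑ a, margA p a = ∑ x, p x := by
  simp only [margA, Fintype.sum_prod_type]

theorem sum_margB [Fintype α] [Fintype β] (p : α × β → ℝ) :
    ∑ b, margB p b = ∑ x, p x := by
  simp only [margB, Fintype.sum_prod_type_right]

theorem le_margA [Fintype α] [Fintype β] {p : α × β → ℝ} (hp : IsPMF p) (a : α) (b : β) :
    p (a, b) ≤ margA p a :=
  Finset.single_le_sum (f := fun b => p (a, b)) (fun _ _ => hp.1 _) (Finset.mem_univ b)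

theorem le_margB [Fintype α] [Fintype β] {p : α × β → ℝ} (hp : IsPMF p) (a : α) (b : β) :
    p (a, b) ≤ margB p b :=
  Finset.single_le_sum (f := fun a => p (a, b)) (fun _ _ => hp.1 _) (Finset.mem_univ a)

theorem sum_margA_mul_margB [Fintype α] [Fintype β] {p : α × β → ℝ} (hp : IsPMF p) :
    ∑ x : α × β, margA p x.1 * margB p x.2 = 1 := by
  rw [Fintype.sum_prod_type, ← Finset.sum_mul_sum, sum_margA, sum_margB, hp.2, one_mul]

theorem ent_mul_log_two [Fintype α] (p : α → ℝ) :
    ent p * Real.log 2 = -∑ a, p a * Real.log (p a) := by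
  have h2 : Real.log 2 ≠ 0 := (Real.log_pos one_lt_two).ne'
  rw [ent, Finset.sum_mul, ← Finset.sum_neg_distrib]
  refine Finset.sum_congr rfl fun a _ => ?_
  rw [Real.logb]
  field_simp

/-- Mutual information as a relative entropy, in nats. -/
theorem mi_mul_log_two [Fintype α] [Fintype β] {p : α × β → ℝ} (hp : IsPMF p) :
    mi p * Real.log 2 =
      ∑ x : α × β, (p x * Real.log (p x) - p x * Real.log (margA p x.1 * margB p x.2)) := by
  have hA : ∑ a, margA p a * Real.log (margA p a) =
      ∑ x : α × β, p x * Real.log (margA p x.1) := by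
    rw [Fintype.sum_prod_type]
    exact Finset.sum_congr rfl fun a _ => Finset.sum_mul _ _ _
  have hB : ∑ b, margB p b * Real.log (margB p b) =
      ∑ x : α × β, p x * Real.log (margB p x.2) := by
    rw [Fintype.sum_prod_type_right]
    exact Finset.sum_congr rfl fun b _ => Finset.sum_mul _ _ _
  have hprod (x : α × β) : p x * Real.log (margA p x.1 * margB p x.2) =
      p x * Real.log (margA p x.1) + p x * Real.log (margB p x.2) := by
    rcases (hp.1 x).eq_or_lt with h | h
    · simp [← h]
    · rw [Real.log_mul (h.trans_le (le_margA hp x.1 x.2)).ne'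
        (h.trans_le (le_margB hp x.1 x.2)).ne', mul_add]
  have hX := ent_mul_log_two (margA p)
  have hY := ent_mul_log_two (margB p)
  have hXY := ent_mul_log_two p
  simp only [hprod, Finset.sum_sub_distrib, Finset.sum_add_distrib]
  rw [hA] at hX
  rw [hB] at hY
  rw [mi, sub_mul, add_mul, hX, hY, hXY]
  ring

/-- The termwise form of Gibbs' inequality. -/
theorem gibbs_term_nonneg {s r : ℝ} (hs : 0 ≤ s) (hr : 0 ≤ r) (hsr : r = 0 → s = 0) :
    0 ≤ s * Real.log s - s * Real.log r - s + r := by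
  rcases hs.eq_or_lt with h | h
  · simpa [← h] using hr
  · have hr' : 0 < r := hr.lt_of_ne fun h' => h.ne' (hsr h'.symm)
    have hlog := mul_le_mul_of_nonneg_left (Real.log_le_sub_one_of_pos (div_pos hr' h)) hs
    rw [Real.log_div hr'.ne' h.ne', mul_sub, mul_sub, mul_div_cancel₀ _ h.ne'] at hlog
    linarith

/-- The equality case of the termwise form of Gibbs' inequality. -/
theorem eq_of_gibbs_term_eq_zero {s r : ℝ} (hs : 0 ≤ s) (hr : 0 ≤ r) (hsr : r = 0 → s = 0)
    (h0 : s * Real.log s - s * Real.log r - s + r = 0) : s = r := by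
  rcases hs.eq_or_lt with h | h
  · simpa [← h, eq_comm] using h0
  · have hr' : 0 < r := hr.lt_of_ne fun h' => h.ne' (hsr h'.symm)
    by_contra hne
    have hlog := mul_lt_mul_of_pos_left (Real.log_lt_sub_one_of_pos (div_pos hr' h)
      fun h' => hne ((div_eq_one_iff_eq h.ne').1 h').symm) h
    rw [Real.log_div hr'.ne' h.ne', mul_sub, mul_sub, mul_div_cancel₀ _ h.ne'] at hlog
    linarith

theorem eq_margA_mul_margB_of_mi_nonpos [Fintype α] [Fintype β] {p : α × β → ℝ} (hp : IsPMF p)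
    (hmi : mi p ≤ 0) (x : α × β) : p x = margA p x.1 * margB p x.2 := by
  have hr (x : α × β) : 0 ≤ margA p x.1 * margB p x.2 :=
    mul_nonneg (margA_nonneg hp _) (margB_nonneg hp _)
  have hac (x : α × β) (h : margA p x.1 * margB p x.2 = 0) : p x = 0 := by
    rcases mul_eq_zero.1 h with h | h
    · exact le_antisymm (h ▸ le_margA hp x.1 x.2) (hp.1 x)
    · exact le_antisymm (h ▸ le_margB hp x.1 x.2) (hp.1 x)
  have hnonneg (x : α × β) := gibbs_term_nonneg (hp.1 x) (hr x) (hac x)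
  have hsum : ∑ x : α × β, (p x * Real.log (p x) -
      p x * Real.log (margA p x.1 * margB p x.2) - p x + margA p x.1 * margB p x.2) = 0 := by
    refine le_antisymm ?_ (Finset.sum_nonneg fun x _ => hnonneg x)
    rw [Finset.sum_add_distrib, Finset.sum_sub_distrib, ← mi_mul_log_two hp, hp.2,
      sum_margA_mul_margB hp]
    have := mul_nonpos_of_nonpos_of_nonneg hmi (Real.log_pos one_lt_two).le
    linarith
  exact eq_of_gibbs_term_eq_zero (hp.1 x) (hr x) (hac x)
    ((Finset.sum_eq_zero_iff_of_nonneg fun x _ => hnonneg x).1 hsum x (Finset.mem_univ x))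

theorem mi_eq_zero_of_eq_margA_mul_margB [Fintype α] [Fintype β] {p : α × β → ℝ} (hp : IsPMF p)
    (h : ∀ x, p x = margA p x.1 * margB p x.2) : mi p = 0 := by
  have hmul : mi p * Real.log 2 = 0 := by
    rw [mi_mul_log_two hp]
    exact Finset.sum_eq_zero fun x _ => by rw [← h x, sub_self]
  exact (mul_eq_zero.1 hmul).resolve_right (Real.log_pos one_lt_two).ne'

theorem margA_jointXZ [Fintype α] [Fintype β] [Fintype γ] (p : α × β → ℝ) {q : β → γ → ℝ}
    (hq : IsChannel q) : margA (jointXZ p q) = margA p := by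
  ext a
  simp only [margA, jointXZ]
  rw [Finset.sum_comm]
  simp [← Finset.mul_sum, hq.2]

theorem margB_jointXZ [Fintype α] [Fintype β] [Fintype γ] (p : α × β → ℝ) (q : β → γ → ℝ)
    (z : γ) : margB (jointXZ p q) z = ∑ y, margB p y * q y z := by
  simp only [margB, jointXZ]
  rw [Finset.sum_comm]
  simp [Finset.sum_mul]

theorem margA_jointYZ [Fintype α] [Fintype β] [Fintype γ] (p : α × β → ℝ) {q : β → γ → ℝ}
    (hq : IsChannel q) : margA (jointYZ p q) = margB p := by
  ext b
  simp [margA, jointYZ, ← Finset.mul_sum, hq.2]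

theorem isPMF_jointXZ [Fintype α] [Fintype β] [Fintype γ] {p : α × β → ℝ} {q : β → γ → ℝ}
    (hp : IsPMF p) (hq : IsChannel q) : IsPMF (jointXZ p q) :=
  ⟨fun _ => Finset.sum_nonneg fun _ _ => mul_nonneg (hp.1 _) (hq.1 _ _), by
    rw [← sum_margA, margA_jointXZ p hq, sum_margA, hp.2]⟩

theorem isPMF_jointYZ [Fintype α] [Fintype β] [Fintype γ] {p : α × β → ℝ} {q : β → γ → ℝ}
    (hp : IsPMF p) (hq : IsChannel q) : IsPMF (jointYZ p q) :=
  ⟨fun _ => mul_nonneg (margB_nonneg hp _) (hq.1 _ _), by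
    rw [← sum_margA, margA_jointYZ p hq, sum_margB, hp.2]⟩

/-- A channel from a binary input correlated with `X` whose output is independent of `X`
ignores its input. -/
theorem channel_eq_of_indep [Fintype α] [Fintype γ] {p : α × Bool → ℝ} (hp : IsPMF p)
    (hdep : ¬ ∀ x y, p (x, y) = margA p x * margB p y) {q : Bool → γ → ℝ}
    (h : ∀ x z, jointXZ p q (x, z) = margA p x * margB (jointXZ p q) z) (z : γ) :
    q true z = q false z := by
  have hB : margB p true + margB p false = 1 := by
    rw [← hp.2, ← sum_margB, Fintype.sum_bool]
  by_contra hne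
  have htrue (x : α) : p (x, true) = margA p x * margB p true := by
    have hA : margA p x = p (x, true) + p (x, false) := Fintype.sum_bool _
    have hx := h x z
    simp only [margB_jointXZ, jointXZ, Fintype.sum_bool] at hx
    refine mul_right_cancel₀ (sub_ne_zero.2 hne) ?_
    linear_combination hx + q false z * hA + margA p x * q false z * hB
  refine hdep fun x y => ?_
  have hA : margA p x = p (x, true) + p (x, false) := Fintype.sum_bool _
  cases y
  · linear_combination -htrue x - hA - margA p x * hB
  · exact htrue x

theorem jointYZ_eq_of_indep [Fintype α] [Fintype γ] {p : α × Bool → ℝ} (hp : IsPMF p)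
    (hdep : ¬ ∀ x y, p (x, y) = margA p x * margB p y) {q : Bool → γ → ℝ}
    (h : ∀ x z, jointXZ p q (x, z) = margA p x * margB (jointXZ p q) z) (y : Bool) (z : γ) :
    jointYZ p q (y, z) = margB p y * margB (jointYZ p q) z := by
  have hB : margB p true + margB p false = 1 := by
    rw [← hp.2, ← sum_margB, Fintype.sum_bool]
  have hz := channel_eq_of_indep hp hdep h z
  have hconst : q y z = q false z := by cases y <;> simp [hz]
  have hZ : margB (jointYZ p q) z = q false z := by
    rw [margB, Fintype.sum_bool]
    simp only [jointYZ]
    rw [hz, ← add_mul, hB, one_mul]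
  rw [hZ, jointYZ, hconst]

/-- If `Y` is a non-degenerate binary random variable (`0 < P_Y(1) < 1`)
that is not independent of `X`, then `g_0(X;Y) = 0`; indeed, every `Z` with `X — Y — Z`
Markov and `Z` independent of `X` is also independent of `Y`. -/
theorem stmt7 {𝓧 : Type*} [Fintype 𝓧]
    (p : 𝓧 × Bool → ℝ) (hp : IsPMF p)
    (h0 : 0 < margB p true) (h1 : margB p true < 1)
    (hdep : ¬ ∀ x y, p (x, y) = margA p x * margB p y) :
    g p 0 = 0 ∧
    ∀ (n : ℕ) (q : Bool → Fin n → ℝ), IsChannel q →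
      (∀ x z, jointXZ p q (x, z) = margA p x * margB (jointXZ p q) z) →
      (∀ y z, jointYZ p q (y, z) = margB p y * margB (jointYZ p q) z) := by
  refine ⟨?_, fun n q _ h => jointYZ_eq_of_indep hp hdep h⟩
  have hset : gSet p 0 = {0} := by
    refine Set.eq_singleton_iff_nonempty_unique_mem.2 ⟨?_, ?_⟩
    · have hq : IsChannel fun (_ : Bool) (_ : Fin 1) => (1 : ℝ) := by simp [IsChannel]
      refine ⟨_, 1, _, hq, (mi_eq_zero_of_eq_margA_mul_margB (isPMF_jointXZ hp hq) ?_).le, rfl⟩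
      rintro ⟨x, z⟩
      have hB : ∑ y, margB p y = 1 := by rw [sum_margB, hp.2]
      simp only [margA_jointXZ p hq, margB_jointXZ, mul_one, hB]
      simp [jointXZ, margA]
    · rintro r ⟨n, q, hq, hmi, rfl⟩
      refine mi_eq_zero_of_eq_margA_mul_margB (isPMF_jointYZ hp hq) ?_
      rintro ⟨y, z⟩
      rw [margA_jointYZ p hq]
      refine jointYZ_eq_of_indep hp hdep (fun x z => ?_) y z
      simpa only [margA_jointXZ p hq] using
        eq_margA_mul_margB_of_mi_nonpos (isPMF_jointXZ hp hq) hmi (x, z)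
  rw [g, hset, csSup_singleton]

end RatePrivacy
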